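/- Let the additive monoid ℕ of natural numbers act trivially on the right on a pointed set S, pointed at pt. Then the reduced universal monoid U[S//ℕ] of the pointed action category S//ℕ is isomorphic, as a monoid, to the free monoid on the set of elements of S other than pt (that is, to the reduced free monoid J[S]). -/

import Mathlib

open CategoryTheory

/-- A right action of a monoid `M` on a type `X`. -/
class RightAction (M X : Type) [Monoid M] where
  act : X → M → X
  act_one : ∀ x : X, act x 1 = x
  act_mul : ∀ (x : X) (m k : M), act (act x m) k = act x (m * k)

/-- The action category `X // M` of a right action of a monoid `M` on `X`:
objects are the elements of `X`, and a morphism `x ⟶ y` is an element `m : M`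
with `y = x · m`. -/
structure ActionCat (M X : Type) [Monoid M] [RightAction M X] where
  obj : X

instance (M X : Type) [Monoid M] [RightAction M X] : Category (ActionCat M X) where
  Hom a b := { m : M // RightAction.act a.obj m = b.obj }
  id a := ⟨1, RightAction.act_one a.obj⟩
  comp f g := ⟨f.1 * g.1, by rw [← RightAction.act_mul, f.2, g.2]⟩
  id_comp f := Subtype.ext (one_mul _)
  comp_id f := Subtype.ext (mul_one _)
  assoc f g h := Subtype.ext (mul_assoc _ _ _)



/-- The set of all morphisms of a small category `C`. -/
abbrev Mor (C : Type) [SmallCategory C] : Type := Σ x y : C, x ⟶ y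

/-- The generating relations for the universal monoid `U(C)` on a small category `C`:
the identity `id_x` of each object is related to `1`, and the composite `g ∘ f` of a
composable pair `f : x → y`, `g : y → z` is related to the product `f·g`. -/
def uRel (C : Type) [SmallCategory C] :
    FreeMonoid (Mor C) → FreeMonoid (Mor C) → Prop := fun a b =>
  (∃ x : C, a = FreeMonoid.of ⟨x, x, 𝟙 x⟩ ∧ b = 1) ∨
  (∃ (x y z : C) (f : x ⟶ y) (g : y ⟶ z),
    a = FreeMonoid.of ⟨x, z, f ≫ g⟩ ∧
    b = FreeMonoid.of ⟨x, y, f⟩ * FreeMonoid.of ⟨y, z, g⟩)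

/-- The universal monoid `U(C)` of a small category `C`: the quotient of the free
monoid on the set of all morphisms of `C` by the monoid congruence generated by the
relations `id_x ~ 1` and `(g ∘ f) ~ f·g`. -/
abbrev UMon (C : Type) [SmallCategory C] : Type := (conGen (uRel C)).Quotient

/-- The class `⟦f⟧` in `U(C)` of a morphism `f` of `C`. -/
def UMon.mk {C : Type} [SmallCategory C] {x y : C} (f : x ⟶ y) : UMon C :=
  (conGen (uRel C)).mk' (FreeMonoid.of ⟨x, y, f⟩)

/-- The generating relations for the reduced universal monoid `U[C]` of a pointed
category `(C, pt)`: in addition to the relations of `U(C)`, every endomorphism of the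
basepoint `pt` is related to `1`. -/
def uRedRel (C : Type) [SmallCategory C] (pt : C) :
    FreeMonoid (Mor C) → FreeMonoid (Mor C) → Prop := fun a b =>
  uRel C a b ∨ (∃ e : pt ⟶ pt, a = FreeMonoid.of ⟨pt, pt, e⟩ ∧ b = 1)

/-- The reduced universal monoid `U[C]` of a pointed category `(C, pt)`: the quotient
of the free monoid on the morphisms of `C` by the monoid congruence generated by the
relations `id_x ~ 1`, `(g ∘ f) ~ f·g`, and `e ~ 1` for every endomorphism `e` of `pt`. -/
abbrev URed (C : Type) [SmallCategory C] (pt : C) : Type := (conGen (uRedRel C pt)).Quotient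

/-- The class `⟦f⟧` in `U[C]` of a morphism `f` of `C`. -/
def URed.mk {C : Type} [SmallCategory C] (pt : C) {x y : C} (f : x ⟶ y) : URed C pt :=
  (conGen (uRedRel C pt)).mk' (FreeMonoid.of ⟨x, y, f⟩)

namespace URed

variable {C : Type} [SmallCategory C] {pt : C}

theorem mk_id (x : C) : mk pt (𝟙 x) = 1 :=
  (Con.eq _).2 (ConGen.Rel.of _ _ (Or.inl (Or.inl ⟨x, rfl, rfl⟩)))

theorem mk_comp {x y z : C} (f : x ⟶ y) (g : y ⟶ z) :
    mk pt (f ≫ g) = mk pt f * mk pt g :=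
  (Con.eq _).2 (ConGen.Rel.of _ _ (Or.inl (Or.inr ⟨x, y, z, f, g, rfl, rfl⟩)))

theorem mk_basepoint (e : pt ⟶ pt) : mk pt e = 1 :=
  (Con.eq _).2 (ConGen.Rel.of _ _ (Or.inr ⟨e, rfl, rfl⟩))

theorem hom_ext {N : Type*} [Monoid N] {φ ψ : URed C pt →* N}
    (h : ∀ (x y : C) (f : x ⟶ y), φ (mk pt f) = ψ (mk pt f)) : φ = ψ :=
  Con.hom_ext (FreeMonoid.hom_eq fun ⟨x, y, f⟩ => h x y f)

/-- The universal property of `U[C]`: a functorial assignment of elements of a monoid to the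
morphisms of `C` that kills the endomorphisms of the basepoint extends to `U[C]`. -/
def lift {N : Type*} [Monoid N] (F : ∀ {x y : C}, (x ⟶ y) → N)
    (map_id : ∀ x : C, F (𝟙 x) = 1)
    (map_comp : ∀ {x y z : C} (f : x ⟶ y) (g : y ⟶ z), F (f ≫ g) = F f * F g)
    (map_basepoint : ∀ e : pt ⟶ pt, F e = 1) : URed C pt →* N :=
  (conGen (uRedRel C pt)).lift (FreeMonoid.lift fun f : Mor C => F f.2.2) <|
    Con.conGen_le.2 <| by
      rintro _ _ ((⟨x, rfl, rfl⟩ | ⟨x, y, z, f, g, rfl, rfl⟩) | ⟨e, rfl, rfl⟩)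
      · simp [Con.ker_rel, map_id]
      · simp [Con.ker_rel, map_comp]
      · simp [Con.ker_rel, map_basepoint]

end URed

section TrivialAction

variable {M S : Type} [Monoid M] [RightAction M S]

/-- For a trivial action, the endomorphism of `s` in the action category given by `m`. -/
def ActionCat.endomorphism (htriv : ∀ (s : S) (m : M), RightAction.act s m = s) (s : S) (m : M) :
    (⟨s⟩ : ActionCat M S) ⟶ ⟨s⟩ :=
  (⟨m, htriv s m⟩ : { m : M // RightAction.act s m = s })

/-- For a trivial action, the monoid homomorphism sending `m` to the class of the endomorphism
`m` of `s`. -/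
def URed.ofEndomorphism (htriv : ∀ (s : S) (m : M), RightAction.act s m = s) (pt s : S) :
    M →* URed (ActionCat M S) ⟨pt⟩ where
  toFun m := URed.mk ⟨pt⟩ (ActionCat.endomorphism htriv s m)
  map_one' := URed.mk_id _
  map_mul' m k := URed.mk_comp (ActionCat.endomorphism htriv s m) (ActionCat.endomorphism htriv s k)

theorem URed.mk_eq_ofEndomorphism (htriv : ∀ (s : S) (m : M), RightAction.act s m = s) (pt : S)
    {x y : ActionCat M S} (f : x ⟶ y) :
    URed.mk ⟨pt⟩ f = URed.ofEndomorphism htriv pt x.obj f.1 := by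
  obtain ⟨x⟩ := x
  obtain ⟨y⟩ := y
  obtain ⟨m, hm⟩ := f
  obtain rfl : x = y := (htriv x m).symm.trans hm
  rfl

open Classical in
/-- The element of the reduced free monoid `J[S]` represented by `s`, which is `1` at the
basepoint. -/
noncomputable def reducedOf (pt s : S) : FreeMonoid {s : S // s ≠ pt} :=
  if h : s = pt then 1 else FreeMonoid.of ⟨s, h⟩

theorem reducedOf_self (pt : S) : reducedOf pt pt = 1 :=
  dif_pos rfl

theorem reducedOf_of_ne {pt s : S} (h : s ≠ pt) : reducedOf pt s = FreeMonoid.of ⟨s, h⟩ :=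
  dif_neg h

end TrivialAction

/-- Let the additive monoid `ℕ` of natural numbers (written multiplicatively as
`Multiplicative ℕ`) act trivially on the right on a pointed type `S`, pointed at `pt`.
Then the reduced universal monoid `U[S // ℕ]` of the pointed action category `S // ℕ`
is isomorphic, as a monoid, to the free monoid on the set of elements of `S` other
than `pt` (that is, to the reduced free monoid `J[S]`). -/
theorem uRed_nat_trivialAction_iso_freeMonoid (S : Type)
    [RightAction (Multiplicative ℕ) S]
    (htriv : ∀ (s : S) (m : Multiplicative ℕ), RightAction.act s m = s) (pt : S) :
    Nonempty (URed (ActionCat (Multiplicative ℕ) S) ⟨pt⟩ ≃*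
      FreeMonoid {s : S // s ≠ pt}) := by
  have obj_eq {x y : ActionCat (Multiplicative ℕ) S} (f : x ⟶ y) : x.obj = y.obj :=
    (htriv x.obj f.1).symm.trans f.2
  let toFree : URed (ActionCat (Multiplicative ℕ) S) ⟨pt⟩ →* FreeMonoid {s : S // s ≠ pt} :=
    URed.lift (fun {x _} f => reducedOf pt x.obj ^ f.1.toAdd)
      (fun x => pow_zero _)
      (fun {x y z} f g => by
        have h : reducedOf pt y.obj = reducedOf pt x.obj := congrArg _ (obj_eq f).symm
        rw [h]
        exact pow_add _ _ _)
      (fun e => by rw [reducedOf_self, one_pow])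
  let ofFree : FreeMonoid {s : S // s ≠ pt} →* URed (ActionCat (Multiplicative ℕ) S) ⟨pt⟩ :=
    FreeMonoid.lift fun s => URed.ofEndomorphism htriv pt s (Multiplicative.ofAdd 1)
  have ofFree_reducedOf (s : S) :
      ofFree (reducedOf pt s) = URed.ofEndomorphism htriv pt s (Multiplicative.ofAdd 1) := by
    by_cases h : s = pt
    · subst h
      rw [reducedOf_self, map_one]
      exact (URed.mk_basepoint _).symm
    · rw [reducedOf_of_ne h]
      exact FreeMonoid.lift_eval_of _ _
  refine ⟨MonoidHom.toMulEquiv toFree ofFree (URed.hom_ext fun x y f => ?_)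
    (FreeMonoid.hom_eq fun s => ?_)⟩
  · change ofFree (reducedOf pt x.obj ^ f.1.toAdd) = URed.mk ⟨pt⟩ f
    rw [map_pow, ofFree_reducedOf, ← map_pow, ← ofAdd_nsmul, nsmul_one, Nat.cast_id, ofAdd_toAdd,
      URed.mk_eq_ofEndomorphism htriv]
  · change toFree (ofFree (FreeMonoid.of s)) = FreeMonoid.of s
    rw [← reducedOf_of_ne s.2, ofFree_reducedOf]
    exact pow_one _
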